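/- arXiv:1807.03668 — 3 statements merged into one kernel-verified Lean document; each statement's English description precedes it below -/
import Mathlib

section
/- Coordinate Routh reduction for an abelian symmetry (flat connection). Let L : ℝ^m × ℝ^n × ℝ^{n×m} × ℝ^m → ℝ be smooth, written L(x, u, w, z), where z ∈ ℝ^m stands for the gradient of a cyclic scalar field φ (L does not depend on the value of φ itself). Let μ = (μ^1,…,μ^m) : ℝ^m → ℝ^m be smooth with Σ_{k=1}^m ∂μ^k/∂x^k = 0 (the momentum value, closed as an (m−1)-form). Let χ : ℝ^m × ℝ^n × ℝ^{n×m} → ℝ^m be smooth and satisfy the momentum constraint (∂L/∂z_k)(x, u, w, χ(x,u,w)) = μ^k(x) for all (x,u,w) and all k. Define the Routhian R(x,u,w) = L(x, u, w, χ(x,u,w)) − Σ_k μ^k(x) χ_k(x,u,w). Suppose the smooth pair (u, φ) : ℝ^m → ℝ^n × ℝ satisfies the Euler–Lagrange equations of L, namely Σ_k ∂/∂x^k[(∂L/∂w^a_k)(x,u,Du,Dφ)] = (∂L/∂u^a)(x,u,Du,Dφ) for all a and Σ_k ∂/∂x^k[(∂L/∂z_k)(x,u,Du,Dφ)] = 0,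 and suppose (u,φ) has momentum μ and is compatible with χ, i.e. Dφ(x) = χ(x, u(x), Du(x)) for all x (so in particular (∂L/∂z_k)(x,u,Du,Dφ) = μ^k(x)). Then u satisfies the Euler–Lagrange equations of the Routhian: Σ_k ∂/∂x^k[(∂R/∂w^a_k)(x, u(x), Du(x))] = (∂R/∂u^a)(x, u(x), Du(x)) for all x and all a. -/
noncomputable section

/-- Jet coordinates `(x, u, w)` for the reduced fields. -/
abbrev Jet (m n : ℕ) := (Fin m → ℝ) × (Fin n → ℝ) × (Fin n → Fin m → ℝ)

/-- Jet coordinates `(x, u, w, z)` where `z` stands for the gradient of the cyclic field. -/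
abbrev Jet4 (m n : ℕ) :=
  (Fin m → ℝ) × (Fin n → ℝ) × (Fin n → Fin m → ℝ) × (Fin m → ℝ)

/-- Partial derivative `∂f/∂x^k` of a scalar function on `ℝ^m`. -/
def pd {m : ℕ} (f : (Fin m → ℝ) → ℝ) (k : Fin m) (x : Fin m → ℝ) : ℝ :=
  fderiv ℝ f x (Pi.single k 1)

/-- `∂R/∂u^a` for a reduced Lagrangian `R(x,u,w)`. -/
def dRu {m n : ℕ} (R : Jet m n → ℝ) (q : Jet m n) (a : Fin n) : ℝ :=
  fderiv ℝ R q (0, Pi.single a 1, 0)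

/-- `∂R/∂w^a_k` for a reduced Lagrangian `R(x,u,w)`. -/
def dRw {m n : ℕ} (R : Jet m n → ℝ) (q : Jet m n) (a : Fin n) (k : Fin m) : ℝ :=
  fderiv ℝ R q (0, 0, Pi.single a (Pi.single k 1))

/-- `∂L/∂u^a` for a Lagrangian `L(x,u,w,z)` with a cyclic field. -/
def dLu {m n : ℕ} (L : Jet4 m n → ℝ) (q : Jet4 m n) (a : Fin n) : ℝ :=
  fderiv ℝ L q (0, Pi.single a 1, 0, 0)

/-- `∂L/∂w^a_k` for a Lagrangian `L(x,u,w,z)` with a cyclic field. -/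
def dLw {m n : ℕ} (L : Jet4 m n → ℝ) (q : Jet4 m n) (a : Fin n) (k : Fin m) : ℝ :=
  fderiv ℝ L q (0, 0, Pi.single a (Pi.single k 1), 0)

/-- `∂L/∂z_k` for a Lagrangian `L(x,u,w,z)` with a cyclic field. -/
def dLz {m n : ℕ} (L : Jet4 m n → ℝ) (q : Jet4 m n) (k : Fin m) : ℝ :=
  fderiv ℝ L q (0, 0, 0, Pi.single k 1)

/-- First jet `j¹u(x) = (x, u(x), Du(x))` of the reduced fields. -/
def J1 {m n : ℕ} (u : (Fin m → ℝ) → Fin n → ℝ) (x : Fin m → ℝ) : Jet m n :=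
  (x, u x, fun a k => pd (fun y => u y a) k x)

/-- First jet `(x, u(x), Du(x), Dφ(x))` of the pair `(u, φ)`. -/
def J14 {m n : ℕ} (u : (Fin m → ℝ) → Fin n → ℝ) (φ : (Fin m → ℝ) → ℝ)
    (x : Fin m → ℝ) : Jet4 m n :=
  (x, u x, fun a k => pd (fun y => u y a) k x, fun k => pd φ k x)

/-- By the momentum constraint, the derivative of the Routhian in a direction that fixes `x`
is the derivative of the Lagrangian in the same direction with `z` held fixed. -/
theorem fderiv_routhian_apply {m n : ℕ} {L : Jet4 m n → ℝ} {μ : (Fin m → ℝ) → Fin m → ℝ}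
    {χ : Jet m n → Fin m → ℝ} {q : Jet m n}
    (hL : DifferentiableAt ℝ L (q.1, q.2.1, q.2.2, χ q)) (hμ : DifferentiableAt ℝ μ q.1)
    (hχ : DifferentiableAt ℝ χ q) (hmom : ∀ k, dLz L (q.1, q.2.1, q.2.2, χ q) k = μ q.1 k)
    (v : Fin n → ℝ) (w : Fin n → Fin m → ℝ) :
    fderiv ℝ (fun q : Jet m n => L (q.1, q.2.1, q.2.2, χ q) - ∑ k, μ q.1 k * χ q k) q (0, v, w) =
      fderiv ℝ L (q.1, q.2.1, q.2.2, χ q) (0, v, w, 0) := by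
  have hsnd : HasFDerivAt (fun q : Jet m n => q.2) (ContinuousLinearMap.snd ℝ _ _) q :=
    hasFDerivAt_snd
  have hfst : HasFDerivAt (fun q : Jet m n => q.1) (ContinuousLinearMap.fst ℝ _ _) q :=
    hasFDerivAt_fst
  have hlift := hfst.prodMk (hsnd.fst.prodMk (hsnd.snd.prodMk hχ.hasFDerivAt))
  have hpair : ∀ k ∈ Finset.univ, HasFDerivAt (fun q : Jet m n => μ q.1 k * χ q k) _ q :=
    fun k _ => (hasFDerivAt_pi'.1 (hμ.hasFDerivAt.comp q hfst) k).mul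
      (hasFDerivAt_pi'.1 hχ.hasFDerivAt k)
  have hz : ∀ z : Fin m → ℝ, fderiv ℝ L (q.1, q.2.1, q.2.2, χ q) (0, 0, 0, z) =
      ∑ k, μ q.1 k * z k := by
    intro z
    have hlin := LinearMap.pi_apply_eq_sum_univ
      ((fderiv ℝ L (q.1, q.2.1, q.2.2, χ q)).toLinearMap ∘ₗ LinearMap.inr ℝ _ _ ∘ₗ
        LinearMap.inr ℝ _ _ ∘ₗ LinearMap.inr ℝ _ _) z
    refine hlin.trans (Finset.sum_congr rfl fun k _ => ?_)
    rw [← hmom k, smul_eq_mul, mul_comm]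
    refine congrArg (fun e => fderiv ℝ L (q.1, q.2.1, q.2.2, χ q) (0, 0, 0, e) * z k) ?_
    ext j
    simp [Pi.single_apply, eq_comm]
  have hsplit : ((0, v, w, fderiv ℝ χ q (0, v, w)) : Jet4 m n) =
      (0, v, w, 0) + (0, 0, 0, fderiv ℝ χ q (0, v, w)) := by simp
  have hR := (hL.hasFDerivAt.comp q hlift).sub (HasFDerivAt.fun_sum hpair)
  refine (congrArg (fun A => A (0, v, w)) hR.fderiv).trans ?_
  suffices fderiv ℝ L (q.1, q.2.1, q.2.2, χ q) (0, v, w, fderiv ℝ χ q (0, v, w)) -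
      ∑ k, μ q.1 k * fderiv ℝ χ q (0, v, w) k =
      fderiv ℝ L (q.1, q.2.1, q.2.2, χ q) (0, v, w, 0) by
    simpa using this
  rw [hsplit, map_add, hz, add_sub_cancel_right]

/-- Coordinate Routh reduction for an abelian symmetry with the flat connection: if
`(u, φ)` solves the Euler–Lagrange equations of `L`, has momentum `μ` and is compatible
with the momentum-constraint solution `χ`, then `u` solves the Euler–Lagrange equations
of the Routhian `R(x,u,w) = L(x,u,w,χ(x,u,w)) − Σ_k μ^k(x) χ_k(x,u,w)`. -/
theorem statement6 {m n : ℕ}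
    (L : Jet4 m n → ℝ) (hL : ContDiff ℝ (⊤ : ℕ∞) L)
    (μ : (Fin m → ℝ) → Fin m → ℝ) (hμ : ContDiff ℝ (⊤ : ℕ∞) μ)
    (hμdiv : ∀ x : Fin m → ℝ, (∑ k, pd (fun y => μ y k) k x) = 0)
    (χ : Jet m n → Fin m → ℝ) (hχ : ContDiff ℝ (⊤ : ℕ∞) χ)
    (hmom : ∀ (q : Jet m n) (k : Fin m),
        dLz L (q.1, q.2.1, q.2.2, χ q) k = μ q.1 k)
    (R : Jet m n → ℝ)
    (hR : R = fun q : Jet m n =>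
        L (q.1, q.2.1, q.2.2, χ q) - ∑ k, μ q.1 k * χ q k)
    (u : (Fin m → ℝ) → Fin n → ℝ) (hu : ContDiff ℝ (⊤ : ℕ∞) u)
    (φ : (Fin m → ℝ) → ℝ) (hφ : ContDiff ℝ (⊤ : ℕ∞) φ)
    (hELu : ∀ (x : Fin m → ℝ) (a : Fin n),
        (∑ k, pd (fun y => dLw L (J14 u φ y) a k) k x) = dLu L (J14 u φ x) a)
    (hELφ : ∀ x : Fin m → ℝ,
        (∑ k, pd (fun y => dLz L (J14 u φ y) k) k x) = 0)
    (hcomp : ∀ (x : Fin m → ℝ) (k : Fin m), pd φ k x = χ (J1 u x) k) :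
    ∀ (x : Fin m → ℝ) (a : Fin n),
      (∑ k, pd (fun y => dRw R (J1 u y) a k) k x) = dRu R (J1 u x) a := by
  have hJ : ∀ x, J14 u φ x = ((J1 u x).1, (J1 u x).2.1, (J1 u x).2.2, χ (J1 u x)) := by
    intro x
    simp only [J14, hcomp]
    rfl
  have key : ∀ x v w, fderiv ℝ R (J1 u x) (0, v, w) = fderiv ℝ L (J14 u φ x) (0, v, w, 0) := by
    intro x v w
    rw [hJ, hR]
    exact fderiv_routhian_apply (hL.differentiable (by simp) _) (hμ.differentiable (by simp) _)
      (hχ.differentiable (by simp) _) (hmom _) v w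
  intro x a
  simp only [dRw, dRu, key]
  exact hELu x a
end
end

section
/- Coordinate reconstruction for an abelian symmetry (flat connection). Let L : ℝ^m × ℝ^n × ℝ^{n×m} × ℝ^m → ℝ be smooth, written L(x, u, w, z), where z ∈ ℝ^m stands for the gradient of a cyclic scalar field φ (L does not depend on the value of φ itself). Let μ = (μ^1,…,μ^m) : ℝ^m → ℝ^m be smooth with Σ_{k=1}^m ∂μ^k/∂x^k = 0. Let χ : ℝ^m × ℝ^n × ℝ^{n×m} → ℝ^m be smooth with (∂L/∂z_k)(x, u, w, χ(x,u,w)) = μ^k(x) for all (x,u,w) and all k, and define the Routhian R(x,u,w) = L(x, u, w, χ(x,u,w)) − Σ_k μ^k(x) χ_k(x,u,w). Suppose a smooth u : ℝ^m → ℝ^n satisfies the Euler–Lagrange equations of R, and suppose the flat (integrability) condition holds: there exists a smooth φ : ℝ^m → ℝ with ∂φ/∂x^k(x) = χ_k(x, u(x), Du(x)) for all x and k. Then the pair (u, φ) satisfies the Euler–Lagrange equations of L, namely Σ_k ∂/∂x^k[(∂L/∂w^a_k)(x,u,Du,Dφ)] = (∂L/∂u^a)(x,u,Du,Dφ) for all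 a and Σ_k ∂/∂x^k[(∂L/∂z_k)(x,u,Du,Dφ)] = 0, and (u,φ) has momentum μ: (∂L/∂z_k)(x, u(x), Du(x), Dφ(x)) = μ^k(x) for all x and k. -/
noncomputable section

/-- Evaluating a linear map on a vector concentrated in the last block of jet coordinates. -/
theorem map_last_block {m n : ℕ} (A : Jet4 m n →L[ℝ] ℝ) (c : Fin m → ℝ) :
    A (0, 0, 0, c) = ∑ k, c k * A (0, 0, 0, Pi.single k 1) := by
  let B : (Fin m → ℝ) →L[ℝ] ℝ :=
    A ∘L (ContinuousLinearMap.inr ℝ (Fin m → ℝ) _ ∘L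
      ContinuousLinearMap.inr ℝ (Fin n → ℝ) _ ∘L
      ContinuousLinearMap.inr ℝ (Fin n → Fin m → ℝ) (Fin m → ℝ))
  have hB : ∀ d, B d = A (0, 0, 0, d) := fun d => rfl
  rw [← hB, pi_eq_sum_univ' c, map_sum]
  refine Finset.sum_congr rfl fun k _ => ?_
  rw [map_smul, hB, smul_eq_mul, ← pi_eq_sum_univ' c]

/-- Coordinate reconstruction for an abelian symmetry with the flat connection: if `u`
solves the Euler–Lagrange equations of the Routhian `R` and the flat (integrability)
condition holds, i.e. there is `φ` with `Dφ = χ ∘ j¹u`, then `(u, φ)` solves the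
Euler–Lagrange equations of `L` and has momentum `μ`. -/
theorem statement7 {m n : ℕ}
    (L : Jet4 m n → ℝ) (hL : ContDiff ℝ (⊤ : ℕ∞) L)
    (μ : (Fin m → ℝ) → Fin m → ℝ) (hμ : ContDiff ℝ (⊤ : ℕ∞) μ)
    (hμdiv : ∀ x : Fin m → ℝ, (∑ k, pd (fun y => μ y k) k x) = 0)
    (χ : Jet m n → Fin m → ℝ) (hχ : ContDiff ℝ (⊤ : ℕ∞) χ)
    (hmom : ∀ (q : Jet m n) (k : Fin m),
        dLz L (q.1, q.2.1, q.2.2, χ q) k = μ q.1 k)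
    (R : Jet m n → ℝ)
    (hR : R = fun q : Jet m n =>
        L (q.1, q.2.1, q.2.2, χ q) - ∑ k, μ q.1 k * χ q k)
    (u : (Fin m → ℝ) → Fin n → ℝ) (hu : ContDiff ℝ (⊤ : ℕ∞) u)
    (hELR : ∀ (x : Fin m → ℝ) (a : Fin n),
        (∑ k, pd (fun y => dRw R (J1 u y) a k) k x) = dRu R (J1 u x) a)
    (φ : (Fin m → ℝ) → ℝ) (hφ : ContDiff ℝ (⊤ : ℕ∞) φ)
    (hflat : ∀ (x : Fin m → ℝ) (k : Fin m), pd φ k x = χ (J1 u x) k) :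
    (∀ (x : Fin m → ℝ) (a : Fin n),
        (∑ k, pd (fun y => dLw L (J14 u φ y) a k) k x) = dLu L (J14 u φ x) a) ∧
    (∀ x : Fin m → ℝ,
        (∑ k, pd (fun y => dLz L (J14 u φ y) k) k x) = 0) ∧
    (∀ (x : Fin m → ℝ) (k : Fin m), dLz L (J14 u φ x) k = μ x k) := by
  have hJ : ∀ x, J14 u φ x = ((J1 u x).1, (J1 u x).2.1, (J1 u x).2.2, χ (J1 u x)) := by
    intro x
    simp only [J14, J1, Prod.mk.injEq, true_and]
    exact funext (hflat x)
  have hmomentum : ∀ (x : Fin m → ℝ) (k : Fin m), dLz L (J14 u φ x) k = μ x k := by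
    intro x k
    rw [hJ, hmom]
    rfl
  have hderiv : ∀ (x : Fin m → ℝ) (v : Fin n → ℝ) (w : Fin n → Fin m → ℝ),
      fderiv ℝ R (J1 u x) (0, v, w) = fderiv ℝ L (J14 u φ x) (0, v, w, 0) := by
    intro x v w
    rw [hJ, hR]
    exact fderiv_routhian_apply (hL.differentiable (by simp) _) (hμ.differentiable (by simp) _)
      (hχ.differentiable (by simp) _) (hmom _) v w
  refine ⟨fun x a => ?_, fun x => ?_, hmomentum⟩
  · simpa only [dRw, dRu, dLw, dLu, hderiv] using hELR x a
  · simpa only [hmomentum] using hμdiv x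
end
end

section
/- Let ρ, σ, ψ, μ₁, μ₂ : ℝ² → ℝ be smooth functions of (t,x) satisfying the reduced Euler–Lagrange system: ∂ρ/∂x = ψ, ρ = 2μ₂, and σ + 6ρ² + 2∂ψ/∂x = −2μ₁, together with the closedness condition ∂μ₂/∂t = ∂μ₁/∂x and the integrability condition ∂σ/∂x = ∂ρ/∂t. Then ρ satisfies the Korteweg–de Vries equation: ∂ρ/∂t + 6ρ ∂ρ/∂x + ∂³ρ/∂x³ = 0. -/
noncomputable section

/-- Partial derivative in the `t`-direction of a function on the `(t,x)`-plane. -/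
def pdt (f : ℝ × ℝ → ℝ) (p : ℝ × ℝ) : ℝ := fderiv ℝ f p (1, 0)

/-- Partial derivative in the `x`-direction of a function on the `(t,x)`-plane. -/
def pdx (f : ℝ × ℝ → ℝ) (p : ℝ × ℝ) : ℝ := fderiv ℝ f p (0, 1)

theorem contDiff_pdx {f : ℝ × ℝ → ℝ} (hf : ContDiff ℝ (⊤ : ℕ∞) f) :
    ContDiff ℝ (⊤ : ℕ∞) (pdx f) :=
  (hf.fderiv_right (m := (⊤ : ℕ∞)) (by simp)).clm_apply contDiff_const

theorem pdt_const_mul {f : ℝ × ℝ → ℝ} {p : ℝ × ℝ} (c : ℝ) (hf : DifferentiableAt ℝ f p) :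
    pdt (fun q => c * f q) p = c * pdt f p := by
  simp [pdt, fderiv_const_mul hf]

theorem pdx_const_mul {f : ℝ × ℝ → ℝ} {p : ℝ × ℝ} (c : ℝ) (hf : DifferentiableAt ℝ f p) :
    pdx (fun q => c * f q) p = c * pdx f p := by
  simp [pdx, fderiv_const_mul hf]

theorem pdx_add {f g : ℝ × ℝ → ℝ} {p : ℝ × ℝ} (hf : DifferentiableAt ℝ f p)
    (hg : DifferentiableAt ℝ g p) : pdx (fun q => f q + g q) p = pdx f p + pdx g p := by
  simp [pdx, fderiv_fun_add hf hg]

theorem pdx_sq {f : ℝ × ℝ → ℝ} {p : ℝ × ℝ} (hf : DifferentiableAt ℝ f p) :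
    pdx (fun q => f q ^ 2) p = 2 * f p * pdx f p := by
  simp [pdx, fderiv_fun_pow 2 hf]

/-- The reduced Euler–Lagrange system of the Routh-reduced KdV example, together with the
closedness of the momentum `μ = μ₁dt + μ₂dx` and the integrability condition
`∂σ/∂x = ∂ρ/∂t`, implies that `ρ` satisfies the Korteweg–de Vries equation. -/
theorem statement8 (ρ σ ψ μ₁ μ₂ : ℝ × ℝ → ℝ)
    (hρ : ContDiff ℝ (⊤ : ℕ∞) ρ) (hσ : ContDiff ℝ (⊤ : ℕ∞) σ) (hψ : ContDiff ℝ (⊤ : ℕ∞) ψ)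
    (hμ₁ : ContDiff ℝ (⊤ : ℕ∞) μ₁) (hμ₂ : ContDiff ℝ (⊤ : ℕ∞) μ₂)
    (h1 : ∀ p, pdx ρ p = ψ p)
    (h2 : ∀ p, ρ p = 2 * μ₂ p)
    (h3 : ∀ p, σ p + 6 * (ρ p) ^ 2 + 2 * pdx ψ p = -(2 * μ₁ p))
    (hclosed : ∀ p, pdt μ₂ p = pdx μ₁ p)
    (hint : ∀ p, pdx σ p = pdt ρ p) :
    ∀ p, pdt ρ p + 6 * ρ p * pdx ρ p + pdx (pdx (pdx ρ)) p = 0 := by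
  intro p
  obtain rfl : pdx ρ = ψ := funext h1
  have dρ : DifferentiableAt ℝ ρ p := hρ.differentiable (by simp) p
  have dσ : DifferentiableAt ℝ σ p := hσ.differentiable (by simp) p
  have dμ₁ : DifferentiableAt ℝ μ₁ p := hμ₁.differentiable (by simp) p
  have dμ₂ : DifferentiableAt ℝ μ₂ p := hμ₂.differentiable (by simp) p
  have dψ : DifferentiableAt ℝ (pdx (pdx ρ)) p :=
    (contDiff_pdx hψ).differentiable (by simp) p
  have dsq : DifferentiableAt ℝ (fun q => ρ q ^ 2) p := dρ.pow 2
  have dsum : DifferentiableAt ℝ (fun q => σ q + 6 * ρ q ^ 2) p := dσ.add (dsq.const_mul 6)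
  have ht : pdt ρ p = 2 * pdt μ₂ p := by
    rw [← pdt_const_mul 2 dμ₂, ← funext h2]
  have hx : pdx σ p + 6 * (2 * ρ p * pdx ρ p) + 2 * pdx (pdx (pdx ρ)) p = -2 * pdx μ₁ p := by
    rw [← pdx_sq dρ, ← pdx_const_mul 6 dsq, ← pdx_const_mul 2 dψ, ← pdx_add dσ (dsq.const_mul 6),
      ← pdx_add dsum (dψ.const_mul 2), ← pdx_const_mul (-2) dμ₁]
    congr 1
    funext q
    simpa using h3 q
  linarith [hclosed p, hint p]
end
end
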